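/- arXiv:2202.02507 — 3 statements merged into one kernel-verified Lean document; each statement's English description precedes it below -/
import Mathlib

section
/- For every integer j ≥ 1, the function ψ_j(x) = 2^{−j} ψ(2^j x) is continuous, the function x ↦ ψ_j(x) − k₁x is nondecreasing on ℝ, and ψ_j(x) > k₂x for all x ∈ (−2^{−j}, −2^{−j−1}) while ψ_j(x) = k₂x for all x outside (−2^{−j}, −2^{−j−1}). -/
open Real Filter Set

/-- x-coordinate of the intersection of the lines y = k*x and y = -k₂/2 + k₁(x+1/2). -/
noncomputable def xstar (k1 k2 ks : ℝ) : ℝ := (k1 - k2) / (2 * (ks - k1))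

/-- y-coordinate: y* = k* x*. -/
noncomputable def ystar (k1 k2 ks : ℝ) : ℝ := ks * xstar k1 k2 ks

/-- The slope k⁺ = (y* + k₂)/(x* + 1). -/
noncomputable def kplus (k1 k2 ks : ℝ) : ℝ :=
  (ystar k1 k2 ks + k2) / (xstar k1 k2 ks + 1)

/-- The function ψ: equal to k₂x outside (-1, -1/2), and the min of the two lines inside. -/
noncomputable def psi (k1 k2 ks : ℝ) (x : ℝ) : ℝ :=
  if x ∈ Set.Ioo (-1 : ℝ) (-(1 / 2) : ℝ) then
    min (-k2 + kplus k1 k2 ks * (x + 1)) (-k2 / 2 + k1 * (x + 1 / 2))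
  else k2 * x

/-- The rescaled functions ψ_j(x) = 2^(-j) ψ(2^j x). -/
noncomputable def psij (k1 k2 ks : ℝ) (j : ℕ) (x : ℝ) : ℝ :=
  (2 : ℝ) ^ (-(j : ℤ)) * psi k1 k2 ks ((2 : ℝ) ^ j * x)

/-- η(x) = sup_{j ≥ 1} ψ_j(x). -/
noncomputable def eta (k1 k2 ks : ℝ) (x : ℝ) : ℝ :=
  ⨆ j : {j : ℕ // 1 ≤ j}, psij k1 k2 ks j x

/-- h(x) = η(x - d). -/
noncomputable def hfun (k1 k2 ks d : ℝ) (x : ℝ) : ℝ := eta k1 k2 ks (x - d)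

/-- f(x) = k₀ (x - d). -/
noncomputable def ffun (k0 d : ℝ) (x : ℝ) : ℝ := k0 * (x - d)

/-- g(x) = f(-x) - h(-x). -/
noncomputable def gfun (k0 k1 k2 ks d : ℝ) (x : ℝ) : ℝ :=
  ffun k0 d (-x) - hfun k1 k2 ks d (-x)

theorem lt_kplus {k1 k2 ks : ℝ} (hk12 : k1 < k2)
    (hks1 : (k1 + k2) / 2 < ks) (hks2 : ks < k2) : k2 < kplus k1 k2 ks := by
  have hpos : 0 < 2 * (ks - k1) := by linarith
  have hx_gt : -1 < xstar k1 k2 ks := by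
    rw [xstar, lt_div_iff₀ hpos]
    linarith
  have hx_neg : xstar k1 k2 ks < 0 := div_neg_of_neg_of_pos (by linarith) hpos
  rw [kplus, ystar, lt_div_iff₀ (by linarith)]
  nlinarith

theorem psi_eq_max {k1 k2 ks : ℝ} (hk12 : k1 < k2) (hk : k2 < kplus k1 k2 ks) (x : ℝ) :
    psi k1 k2 ks x =
      max (k2 * x) (min (-k2 + kplus k1 k2 ks * (x + 1)) (-k2 / 2 + k1 * (x + 1 / 2))) := by
  unfold psi
  split_ifs with hx
  · obtain ⟨h1, h2⟩ := hx
    exact (max_eq_right (le_min (by nlinarith) (by nlinarith))).symm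
  · refine (max_eq_left ?_).symm
    by_cases h1 : x ≤ -1
    · exact (min_le_left _ _).trans (by nlinarith)
    · have h2 : -(1 / 2) ≤ x := by
        by_contra! h
        exact hx ⟨not_le.mp h1, h⟩
      exact (min_le_right _ _).trans (by nlinarith)

theorem lt_psi_of_mem_Ioo {k1 k2 ks x : ℝ} (hk12 : k1 < k2) (hk : k2 < kplus k1 k2 ks)
    (hx : x ∈ Set.Ioo (-1 : ℝ) (-(1 / 2))) : k2 * x < psi k1 k2 ks x := by
  rw [psi, if_pos hx]
  obtain ⟨h1, h2⟩ := hx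
  exact lt_min (by nlinarith) (by nlinarith)

theorem continuous_psi {k1 k2 ks : ℝ} (hk12 : k1 < k2) (hk : k2 < kplus k1 k2 ks) :
    Continuous (psi k1 k2 ks) := by
  rw [funext (psi_eq_max hk12 hk)]
  fun_prop

theorem monotone_psi_sub {k1 k2 ks : ℝ} (hk12 : k1 < k2) (hk : k2 < kplus k1 k2 ks) :
    Monotone (fun x => psi k1 k2 ks x - k1 * x) := by
  intro x y hxy
  simp only [psi_eq_max hk12 hk, ← max_sub_sub_right, ← min_sub_sub_right]
  exact max_le_max (by nlinarith) (min_le_min (by nlinarith) (by nlinarith))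

theorem two_pow_mul_mem_Ioo_iff (j : ℕ) (x : ℝ) :
    (2 : ℝ) ^ j * x ∈ Set.Ioo (-1 : ℝ) (-(1 / 2)) ↔
      x ∈ Set.Ioo (-(2 : ℝ) ^ (-(j : ℤ))) (-(2 : ℝ) ^ (-(j : ℤ) - 1)) := by
  have hp : (0 : ℝ) < 2 ^ j := by positivity
  have h1 : (2 : ℝ) ^ j * (-(2 : ℝ) ^ (-(j : ℤ))) = -1 := by
    rw [zpow_neg, zpow_natCast]
    field_simp
  have h2 : (2 : ℝ) ^ j * (-(2 : ℝ) ^ (-(j : ℤ) - 1)) = -(1 / 2) := by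
    rw [zpow_sub_one₀ two_ne_zero, zpow_neg, zpow_natCast]
    field_simp
  rw [Set.mem_Ioo, Set.mem_Ioo, ← h1, ← h2, mul_lt_mul_iff_right₀ hp, mul_lt_mul_iff_right₀ hp]

/-- properties of ψ_j for j ≥ 1. -/
theorem stmt_2 (k1 k2 ks : ℝ) (hk1 : 0 < k1) (hk12 : k1 < k2)
    (hks1 : (k1 + k2) / 2 < ks) (hks2 : ks < k2) :
    ∀ j : ℕ, 1 ≤ j →
      Continuous (psij k1 k2 ks j) ∧
      Monotone (fun x => psij k1 k2 ks j x - k1 * x) ∧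
      (∀ x ∈ Set.Ioo (-(2 : ℝ) ^ (-(j : ℤ))) (-(2 : ℝ) ^ (-(j : ℤ) - 1)),
        k2 * x < psij k1 k2 ks j x) ∧
      (∀ x : ℝ, x ∉ Set.Ioo (-(2 : ℝ) ^ (-(j : ℤ))) (-(2 : ℝ) ^ (-(j : ℤ) - 1)) →
        psij k1 k2 ks j x = k2 * x) := by
  intro j _
  have hk := lt_kplus hk12 hks1 hks2
  have hc : (0 : ℝ) < 2 ^ (-(j : ℤ)) := by positivity
  have hscale (k x : ℝ) : k * x = (2 : ℝ) ^ (-(j : ℤ)) * (k * ((2 : ℝ) ^ j * x)) := by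
    rw [zpow_neg, zpow_natCast]
    field_simp
  refine ⟨?_, ?_, fun x hx => ?_, fun x hx => ?_⟩
  · exact continuous_const.mul ((continuous_psi hk12 hk).comp (continuous_const.mul continuous_id))
  · intro x y hxy
    have hxy' : (2 : ℝ) ^ j * x ≤ 2 ^ j * y := by gcongr
    have h := mul_le_mul_of_nonneg_left (monotone_psi_sub hk12 hk hxy') hc.le
    simpa only [psij, mul_sub, ← hscale] using h
  · rw [hscale, psij]
    exact mul_lt_mul_of_pos_left
      (lt_psi_of_mem_Ioo hk12 hk ((two_pow_mul_mem_Ioo_iff j x).mpr hx)) hc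
  · rw [psij, psi, if_neg (mt (two_pow_mul_mem_Ioo_iff j x).mp hx), ← hscale]
end

section
/- (Lemma 1) For every real λ ≥ 0 there exists a unique z ∈ ℝ such that λz + h(z) = 0, where h(x) = η(x − d). Moreover, for λ = 0 the unique solution is z = d. -/
open Real Filter Set

/-- All difference quotients of `f` lie in `[c, C]`. -/
def SlopesIn (c C : ℝ) (f : ℝ → ℝ) : Prop :=
  ∀ ⦃x y : ℝ⦄, x ≤ y → c * (y - x) ≤ f y - f x ∧ f y - f x ≤ C * (y - x)

namespace SlopesIn

variable {c C : ℝ} {f g : ℝ → ℝ}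

theorem affine {m : ℝ} (hc : c ≤ m) (hC : m ≤ C) (a b : ℝ) :
    SlopesIn c C fun x => a + m * (x + b) := by
  intro x y hxy
  constructor
  · nlinarith [mul_le_mul_of_nonneg_right hc (sub_nonneg.2 hxy)]
  · nlinarith [mul_le_mul_of_nonneg_right hC (sub_nonneg.2 hxy)]

theorem max (hf : SlopesIn c C f) (hg : SlopesIn c C g) :
    SlopesIn c C fun x => Max.max (f x) (g x) := by
  intro x y hxy
  obtain ⟨hf₁, hf₂⟩ := hf hxy
  obtain ⟨hg₁, hg₂⟩ := hg hxy
  dsimp only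
  rcases max_cases (f x) (g x) with h | h <;> rcases max_cases (f y) (g y) with h' | h' <;>
    constructor <;> linarith

theorem min (hf : SlopesIn c C f) (hg : SlopesIn c C g) :
    SlopesIn c C fun x => Min.min (f x) (g x) := by
  intro x y hxy
  obtain ⟨hf₁, hf₂⟩ := hf hxy
  obtain ⟨hg₁, hg₂⟩ := hg hxy
  dsimp only
  rcases min_cases (f x) (g x) with h | h <;> rcases min_cases (f y) (g y) with h' | h' <;>
    constructor <;> linarith

theorem rescale (hf : SlopesIn c C f) {r : ℝ} (hr : 0 < r) :
    SlopesIn c C fun x => r⁻¹ * f (r * x) := by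
  intro x y hxy
  obtain ⟨h₁, h₂⟩ := hf (mul_le_mul_of_nonneg_left hxy hr.le)
  rw [← mul_sub, mul_left_comm] at h₁ h₂
  dsimp only
  rw [← mul_sub]
  exact ⟨(le_inv_mul_iff₀ hr).2 h₁, (inv_mul_le_iff₀ hr).2 h₂⟩

theorem iSup {ι : Type*} [Nonempty ι] {F : ι → ℝ → ℝ} (hF : ∀ i, SlopesIn c C (F i))
    (hb : ∀ x, BddAbove (range fun i => F i x)) : SlopesIn c C fun x => ⨆ i, F i x := by
  intro x y hxy
  constructor
  · have : ⨆ i, F i x ≤ (⨆ i, F i y) - c * (y - x) :=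
      ciSup_le fun i => by linarith [(hF i hxy).1, le_ciSup (hb y) i]
    dsimp only
    linarith
  · have : ⨆ i, F i y ≤ (⨆ i, F i x) + C * (y - x) :=
      ciSup_le fun i => by linarith [(hF i hxy).2, le_ciSup (hb x) i]
    dsimp only
    linarith

theorem strictMono (hf : SlopesIn c C f) (hc : 0 < c) : StrictMono f := fun x y hxy => by
  linarith [(hf hxy.le).1, mul_pos hc (sub_pos.2 hxy)]

theorem continuous (hf : SlopesIn c C f) (hc : 0 ≤ c) : Continuous f := by
  refine (LipschitzWith.of_le_add_mul (Real.toNNReal C) fun x y => ?_).continuous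
  rw [Real.dist_eq]
  have hC : C * |x - y| ≤ Real.toNNReal C * |x - y| :=
    mul_le_mul_of_nonneg_right (Real.le_coe_toNNReal C) (abs_nonneg _)
  rcases le_total x y with h | h
  · have : 0 ≤ (Real.toNNReal C : ℝ) * |x - y| := by positivity
    linarith [(hf h).1, mul_nonneg hc (sub_nonneg.2 h)]
  · rw [abs_of_nonneg (sub_nonneg.2 h)] at *
    linarith [(hf h).2]

end SlopesIn

section

variable {k1 k2 ks : ℝ}

theorem le_kplus (hk12 : k1 < k2) (hks1 : (k1 + k2) / 2 < ks) (hks2 : ks < k2) :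
    k2 ≤ kplus k1 k2 ks := by
  have hpos : 0 < 2 * (ks - k1) := by linarith
  have hx : xstar k1 k2 ks < 0 := div_neg_of_neg_of_pos (sub_neg.2 hk12) hpos
  have hx' : -1 < xstar k1 k2 ks := by
    rw [xstar, lt_div_iff₀ hpos]
    linarith
  rw [kplus, ystar, le_div_iff₀ (by linarith)]
  nlinarith

theorem psi_eq_max_min (hk12 : k1 ≤ k2) (hk : k2 ≤ kplus k1 k2 ks) (x : ℝ) :
    psi k1 k2 ks x = max (0 + k2 * (x + 0))
      (min (-k2 + kplus k1 k2 ks * (x + 1)) (-k2 / 2 + k1 * (x + 1 / 2))) := by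
  rw [psi]
  split_ifs with h
  · refine (max_eq_right (le_min ?_ ?_)).symm
    · nlinarith [h.1]
    · nlinarith [h.2]
  · rw [max_eq_left, zero_add, add_zero]
    rcases le_or_gt x (-1) with hx | hx
    · exact (min_le_left _ _).trans (by nlinarith)
    · have : -(1 / 2) ≤ x := not_lt.1 fun h' => h ⟨hx, h'⟩
      exact (min_le_right _ _).trans (by nlinarith)

theorem slopesIn_psi (hk12 : k1 ≤ k2) (hk : k2 ≤ kplus k1 k2 ks) :
    SlopesIn k1 (kplus k1 k2 ks) (psi k1 k2 ks) := by
  rw [funext (psi_eq_max_min hk12 hk)]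
  exact (SlopesIn.affine hk12 hk _ _).max
    ((SlopesIn.affine (hk12.trans hk) le_rfl _ _).min
      (SlopesIn.affine le_rfl (hk12.trans hk) _ _))

theorem slopesIn_psij (hk12 : k1 ≤ k2) (hk : k2 ≤ kplus k1 k2 ks) (j : ℕ) :
    SlopesIn k1 (kplus k1 k2 ks) (psij k1 k2 ks j) := by
  have h := (slopesIn_psi hk12 hk).rescale (r := 2 ^ j) (by positivity)
  intro x y hxy
  simpa only [psij, zpow_neg, zpow_natCast] using h hxy

theorem psij_zero (j : ℕ) : psij k1 k2 ks j 0 = 0 := by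
  have : (0 : ℝ) ∉ Ioo (-1 : ℝ) (-(1 / 2)) := fun h => by linarith [h.2]
  rw [psij, mul_zero, psi, if_neg this, mul_zero, mul_zero]

instance : Nonempty {j : ℕ // 1 ≤ j} := ⟨⟨1, le_rfl⟩⟩

theorem eta_zero : eta k1 k2 ks 0 = 0 := by
  simp only [eta, psij_zero, ciSup_const]

theorem slopesIn_eta (hk1 : 0 ≤ k1) (hk12 : k1 ≤ k2) (hk : k2 ≤ kplus k1 k2 ks) :
    SlopesIn k1 (kplus k1 k2 ks) (eta k1 k2 ks) := by
  refine SlopesIn.iSup (F := fun (j : {j : ℕ // 1 ≤ j}) => psij k1 k2 ks j)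
    (fun j => slopesIn_psij hk12 hk j) fun x => ⟨kplus k1 k2 ks * |x|, ?_⟩
  rintro _ ⟨j, rfl⟩
  have hj := slopesIn_psij hk12 hk j
  have h0 : psij k1 k2 ks j 0 = 0 := psij_zero _
  have hK : 0 ≤ kplus k1 k2 ks := hk1.trans (hk12.trans hk)
  rcases le_total 0 x with h | h
  · rw [abs_of_nonneg h]
    linarith [(hj h).2]
  · nlinarith [(hj h).1, mul_nonneg hK (abs_nonneg x)]

end

/-- Lemma 1: for every λ ≥ 0 the equation λz + h(z) = 0 has a unique
solution, and for λ = 0 the unique solution is z = d. -/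
theorem stmt_6 (k1 k2 ks d : ℝ) (hk1 : 0 < k1) (hk12 : k1 < k2)
    (hks1 : (k1 + k2) / 2 < ks) (hks2 : ks < k2) (hd : 1 ≤ d) :
    (∀ l : ℝ, 0 ≤ l → ∃! z : ℝ, l * z + hfun k1 k2 ks d z = 0) ∧
    (∀ z : ℝ, 0 * z + hfun k1 k2 ks d z = 0 ↔ z = d) := by
  have hη := slopesIn_eta hk1.le hk12.le (le_kplus hk12 hks1 hks2)
  have hmono : StrictMono (hfun k1 k2 ks d) := fun x y hxy =>
    hη.strictMono hk1 (sub_lt_sub_right hxy d)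
  have hcont : Continuous (hfun k1 k2 ks d) :=
    (hη.continuous hk1.le).comp (continuous_id.sub continuous_const)
  have hroot : hfun k1 k2 ks d d = 0 := by rw [hfun, sub_self, eta_zero]
  refine ⟨fun l hl => ?_, fun z => ?_⟩
  · have hs : StrictMono fun z => l * z + hfun k1 k2 ks d z := fun x y hxy =>
      add_lt_add_of_le_of_lt (mul_le_mul_of_nonneg_left hxy.le hl) (hmono hxy)
    have hc : Continuous fun z => l * z + hfun k1 k2 ks d z :=
      (continuous_const.mul continuous_id).add hcont
    have hd0 : 0 ≤ d := zero_le_one.trans hd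
    have hmem : (0 : ℝ) ∈ Icc (l * 0 + hfun k1 k2 ks d 0) (l * d + hfun k1 k2 ks d d) := by
      rw [mul_zero, zero_add, hroot, add_zero]
      exact ⟨(hmono.monotone hd0).trans_eq hroot, mul_nonneg hl hd0⟩
    obtain ⟨z, -, hz⟩ := intermediate_value_Icc hd0 hc.continuousOn hmem
    exact ⟨z, hz, fun w hw => hs.injective (hw.trans hz.symm)⟩
  · rw [zero_mul, zero_add, ← hroot]
    exact hmono.injective.eq_iff
end

section
/- (Boundedness of the family of solutions) For every λ > 0, the unique solution (u_λ, v_λ) of the system λu + f(u − v) = 0, λv + g(v − u) = 0 satisfies 0 ≤ u_λ ≤ d and −d ≤ v_λ ≤ 0; in particular the family {(u_λ, v_λ)}_{λ>0} is bounded in ℝ². -/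
open Real Filter Set

theorem psi_le_of_nonpos {k1 k2 : ℝ} (ks : ℝ) (hk12 : k1 ≤ k2) {x : ℝ} (hx : x ≤ 0) :
    psi k1 k2 ks x ≤ k1 * x := by
  unfold psi
  split_ifs with h
  · refine (min_le_right _ _).trans ?_
    linarith
  · exact mul_le_mul_of_nonpos_right hk12 hx

theorem psi_nonneg_of_nonneg {k2 : ℝ} (k1 ks : ℝ) (hk2 : 0 ≤ k2) {x : ℝ} (hx : 0 ≤ x) :
    0 ≤ psi k1 k2 ks x := by
  unfold psi
  rw [if_neg fun h => by linarith [h.2]]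
  positivity

theorem eta_le_of_nonpos {k1 k2 : ℝ} (ks : ℝ) (hk12 : k1 ≤ k2) {x : ℝ} (hx : x ≤ 0) :
    eta k1 k2 ks x ≤ k1 * x := by
  have : Nonempty {j : ℕ // 1 ≤ j} := ⟨⟨1, le_rfl⟩⟩
  refine ciSup_le fun j => ?_
  have hpos : (0 : ℝ) < 2 ^ (j : ℕ) := by positivity
  calc psij k1 k2 ks j x
      ≤ (2 : ℝ) ^ (-((j : ℕ) : ℤ)) * (k1 * (2 ^ (j : ℕ) * x)) :=
        mul_le_mul_of_nonneg_left
          (psi_le_of_nonpos ks hk12 (mul_nonpos_of_nonneg_of_nonpos hpos.le hx)) (by positivity)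
    _ = k1 * x := by
        rw [zpow_neg, zpow_natCast]
        field_simp

theorem eta_nonneg_of_nonneg {k2 : ℝ} (k1 ks : ℝ) (hk2 : 0 ≤ k2) {x : ℝ} (hx : 0 ≤ x) :
    0 ≤ eta k1 k2 ks x :=
  Real.iSup_nonneg fun _ =>
    mul_nonneg (by positivity) (psi_nonneg_of_nonneg k1 ks hk2 (by positivity))

/-- every solution of the discounted system satisfies 0 ≤ u ≤ d and
−d ≤ v ≤ 0; in particular the family of solutions is bounded. -/
theorem stmt_17 (k1 k2 ks d k0 : ℝ) (hk1 : 0 < k1) (hk12 : k1 < k2)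
    (hks1 : (k1 + k2) / 2 < ks) (hks2 : ks < k2) (hd : 1 ≤ d)
    (hk00 : 0 < k0) (hk01 : k0 < k1) :
    ∀ l : ℝ, 0 < l → ∀ u v : ℝ,
      l * u + ffun k0 d (u - v) = 0 →
      l * v + gfun k0 k1 k2 ks d (v - u) = 0 →
      0 ≤ u ∧ u ≤ d ∧ -d ≤ v ∧ v ≤ 0 := by
  intro l hl u v hu hv
  simp only [gfun, hfun, ffun, neg_sub] at hu hv
  obtain ⟨t, ht⟩ : ∃ t, t = u - v - d := ⟨_, rfl⟩
  rw [← ht] at hu hv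
  have hsum : l * (t + d) + eta k1 k2 ks t = 0 := by
    rw [ht] at hu hv ⊢
    linarith
  have htneg : t < 0 := by
    by_contra! h
    have h1 := eta_nonneg_of_nonneg k1 ks (hk1.trans hk12).le h
    have h2 : 0 < l * (t + d) := mul_pos hl (by linarith)
    linarith
  have heta := eta_le_of_nonpos ks hk12.le htneg.le
  have hk : k1 * t ≤ k0 * t := mul_le_mul_of_nonpos_right hk01.le htneg.le
  have hkt : k0 * t < 0 := mul_neg_of_pos_of_neg hk00 htneg
  have hlt : l * t < 0 := mul_neg_of_pos_of_neg hl htneg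
  have hu0 : 0 ≤ u := le_of_mul_le_mul_left (by linarith) hl
  exact ⟨hu0, le_of_mul_le_mul_left (by linarith) hl, by linarith,
    le_of_mul_le_mul_left (by linarith) hl⟩
end
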